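/- Fix n, l ∈ ℕ with n > l ≥ 1. Equip ℂ[z₁,z₂] with the hermitian inner product determined by declaring distinct monomials orthogonal and ⟨z₁^a z₂^b, z₁^a z₂^b⟩ = a!·b!, and equip P_n ⊗ P_l with the induced product inner product. Let h = Σ_{k=0}^{l} (−1)^k binom(l,k) z₂^k z₁^{n−k} ⊗ z₁^k z₂^{l−k}, let w₋ = ½(z₂∂₁ ⊗ 1)h, and let v = (X₋⊗1 + 1⊗X₋)h where X₋ = z₂∂₁. Then ⟨v, w₋⟩ / ⟨v, v⟩ = (n+2) / (2(n−l+2)). -/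

import Mathlib

open MvPolynomial

/-- Multiplication by the variable `zᵢ` ("creation operator" `aᵢ† = zᵢ`). -/
noncomputable def mulZ (i : Fin 2) : Module.End ℂ (MvPolynomial (Fin 2) ℂ) :=
  LinearMap.mulLeft ℂ (X i)

/-- The su(2) generators `X₁ = ½(z₁∂₂ + z₂∂₁)`, `X₂ = −(i/2)(z₁∂₂ − z₂∂₁)`,
`X₃ = ½(z₁∂₁ − z₂∂₂)` acting on `ℂ[z₁,z₂]` (variables indexed by `0, 1`,
operators indexed by `0, 1, 2`). -/
noncomputable def Xop : Fin 3 → Module.End ℂ (MvPolynomial (Fin 2) ℂ)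
  | 0 => ((1:ℂ)/2) • (mulZ 0 ∘ₗ (pderiv (R := ℂ) (1 : Fin 2)).toLinearMap
            + mulZ 1 ∘ₗ (pderiv (R := ℂ) (0 : Fin 2)).toLinearMap)
  | 1 => (-Complex.I/2) • (mulZ 0 ∘ₗ (pderiv (R := ℂ) (1 : Fin 2)).toLinearMap
            - mulZ 1 ∘ₗ (pderiv (R := ℂ) (0 : Fin 2)).toLinearMap)
  | 2 => ((1:ℂ)/2) • (mulZ 0 ∘ₗ (pderiv (R := ℂ) (0 : Fin 2)).toLinearMap
            - mulZ 1 ∘ₗ (pderiv (R := ℂ) (1 : Fin 2)).toLinearMap)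

/-- The totally antisymmetric Levi-Civita symbol `ε_{abc}` on `{0,1,2}` with `ε₀₁₂ = 1`. -/
noncomputable def eps (a b c : Fin 3) : ℂ :=
  (((b : ℤ) - (a : ℤ)) * ((c : ℤ) - (a : ℤ)) * ((c : ℤ) - (b : ℤ)) : ℂ) / 2


open TensorProduct

/-- The identity operator on `ℂ[z₁,z₂]`. -/
noncomputable def idP : Module.End ℂ (MvPolynomial (Fin 2) ℂ) := LinearMap.id

/-- The Bargmann hermitian inner product on a polynomial ring over `ℂ`: distinct monomials
are orthogonal and `⟨∏ zᵢ^{aᵢ}, ∏ zᵢ^{aᵢ}⟩ = ∏ aᵢ!` (conjugate-linear in the first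
argument). -/
noncomputable def binner {σ : Type*} (p q : MvPolynomial σ ℂ) : ℂ :=
  ∑ m ∈ p.support,
    (starRingEnd ℂ) (p.coeff m) * q.coeff m * (m.prod fun _ k => (k.factorial : ℂ))

/-- The canonical identification of `ℂ[z₁,z₂] ⊗ ℂ[z₁,z₂]` with the polynomial ring in two
pairs of variables, sending `p ⊗ q` to `p(z_left)·q(z_right)`. -/
noncomputable def phi :
    (MvPolynomial (Fin 2) ℂ ⊗[ℂ] MvPolynomial (Fin 2) ℂ) →ₐ[ℂ] MvPolynomial (Fin 2 ⊕ Fin 2) ℂ :=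
  Algebra.TensorProduct.productMap (rename Sum.inl) (rename Sum.inr)

/-- The induced product inner product on `ℂ[z₁,z₂] ⊗ ℂ[z₁,z₂]`: on pure tensors,
`⟨p₁ ⊗ p₂, q₁ ⊗ q₂⟩ = ⟨p₁,q₁⟩·⟨p₂,q₂⟩` for the Bargmann inner products of the factors. -/
noncomputable def tinner (x y : MvPolynomial (Fin 2) ℂ ⊗[ℂ] MvPolynomial (Fin 2) ℂ) : ℂ :=
  binner (phi x) (phi y)

lemma binner_eq_sum_of_support_subset {σ : Type*} (p q : MvPolynomial σ ℂ)
    (s : Finset (σ →₀ ℕ)) (hs : p.support ⊆ s) :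
    binner p q = ∑ m ∈ s,
      (starRingEnd ℂ) (p.coeff m) * q.coeff m * (m.prod fun _ k => (k.factorial : ℂ)) := by
  refine Finset.sum_subset hs fun m _ hm => ?_
  rw [notMem_support_iff.mp hm]
  simp

lemma binner_sum_monomial {σ ι : Type*} (s : Finset ι) (e : ι → σ →₀ ℕ)
    (he : Set.InjOn e s) (α β : ι → ℂ) :
    binner (∑ i ∈ s, monomial (e i) (α i)) (∑ i ∈ s, monomial (e i) (β i)) =
      ∑ i ∈ s, (starRingEnd ℂ) (α i) * β i * ((e i).prod fun _ k => (k.factorial : ℂ)) := by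
  classical
  have hcoeff : ∀ γ : ι → ℂ, ∀ i ∈ s, coeff (e i) (∑ j ∈ s, monomial (e j) (γ j)) = γ i := by
    intro γ i hi
    rw [coeff_sum, Finset.sum_eq_single_of_mem i hi]
    · simp
    · intro j hj hji
      rw [coeff_monomial, if_neg fun h => hji (he hj hi h)]
  rw [binner_eq_sum_of_support_subset _ _ (s.image e), Finset.sum_image he]
  · exact Finset.sum_congr rfl fun i hi => by rw [hcoeff α i hi, hcoeff β i hi]
  · intro m hm
    by_contra hmem
    refine mem_support_iff.mp hm ?_
    rw [coeff_sum]
    refine Finset.sum_eq_zero fun i hi => ?_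
    rw [coeff_monomial, if_neg]
    rintro rfl
    exact hmem (Finset.mem_image_of_mem e hi)

/-- The exponent vector of the monomial `z₂^a z₁^b ⊗ z₁^c z₂^d`. -/
noncomputable def pairExponent (a b c d : ℕ) : Fin 2 ⊕ Fin 2 →₀ ℕ :=
  Finsupp.single (Sum.inl 1) a + Finsupp.single (Sum.inl 0) b +
    (Finsupp.single (Sum.inr 0) c + Finsupp.single (Sum.inr 1) d)

lemma phi_smul_tmul_eq_monomial (r : ℂ) (a b c d : ℕ) :
    phi (r • ((X 1 ^ a * X 0 ^ b) ⊗ₜ[ℂ] (X 0 ^ c * X 1 ^ d))) =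
      monomial (pairExponent a b c d) r := by
  rw [map_smul, phi, Algebra.TensorProduct.productMap_apply_tmul]
  simp only [map_mul, map_pow, rename_X]
  simp only [X_pow_eq_monomial, monomial_mul, pairExponent, smul_monomial, smul_eq_mul, mul_one]

lemma prod_factorial_pairExponent (a b c d : ℕ) :
    ((pairExponent a b c d).prod fun _ k => (k.factorial : ℂ)) =
      a.factorial * b.factorial * (c.factorial * d.factorial) := by
  rw [Finsupp.prod_fintype _ _ (by simp)]
  simp [pairExponent, Fintype.prod_sum_type, Fin.prod_univ_two]
  exact Or.inl (mul_comm _ _)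

lemma lowering_apply_monomial (a b : ℕ) :
    (mulZ 1 ∘ₗ (pderiv (R := ℂ) (0 : Fin 2)).toLinearMap) (X 1 ^ a * X 0 ^ b) =
      (b : ℂ) • (X 1 ^ (a + 1) * X 0 ^ (b - 1)) := by
  simp [mulZ, Derivation.leibniz, Derivation.leibniz_pow, pderiv_X, MvPolynomial.smul_eq_C_mul]
  ring

lemma sum_succ_mul_choose (p l : ℕ) :
    ∑ k ∈ Finset.range (l + 1), (k + 1) * (p + (l - k)).choose p = (p + l + 2).choose (p + 2) := by
  induction l with
  | zero => simp
  | succ l ih =>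
    have hockey : ∑ k ∈ Finset.range (l + 1), (p + (l - k)).choose p
        = (p + l + 1).choose (p + 1) := by
      rw [← Finset.sum_range_reflect, show p + l + 1 = l + p + 1 by ring,
        ← Nat.sum_range_add_choose l p]
      · simp only [Nat.add_comm]
        refine Finset.sum_congr (by ring_nf) fun k hk => ?_
        congr 1
        have := Finset.mem_range.mp hk
        omega
    rw [Finset.sum_range_succ']
    have hstep : ∀ k ∈ Finset.range (l + 1),
        (k + 1 + 1) * (p + (l + 1 - (k + 1))).choose p =
          (k + 1) * (p + (l - k)).choose p + (p + (l - k)).choose p := by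
      intro k _
      rw [Nat.add_sub_add_right]
      ring
    rw [Finset.sum_congr rfl hstep, Finset.sum_add_distrib, ih, hockey]
    have h1 := Nat.choose_succ_succ (p + l + 2) (p + 1)
    have h2 := Nat.choose_succ_succ (p + l + 1) p
    simp only [Nat.succ_eq_add_one] at h1 h2
    simp only [Nat.sub_zero, zero_add, one_mul]
    rw [show p + (l + 1) = p + l + 1 by ring, show p + l + 1 + 2 = p + l + 2 + 1 by ring, h1, h2]
    ring

lemma choose_sq_mul_factorials {l k : ℕ} (p : ℕ) (hk : k ≤ l) :
    (l.choose k : ℂ) ^ 2 *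
        ((k + 1).factorial * (p + (l - k)).factorial * (k.factorial * (l - k).factorial)) =
      (l.factorial : ℂ) ^ 2 * p.factorial * ((k + 1) * (p + (l - k)).choose p) := by
  obtain ⟨j, rfl⟩ := Nat.exists_eq_add_of_le hk
  have h1 : ((k + j).factorial : ℂ) = (k + j).choose k * k.factorial * j.factorial := by
    have := Nat.add_choose_mul_factorial_mul_factorial k j
    rw [← Nat.choose_symm_add] at this
    exact_mod_cast this.symm
  have h2 : ((p + j).factorial : ℂ) = (p + j).choose p * p.factorial * j.factorial := by
    have := Nat.add_choose_mul_factorial_mul_factorial p j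
    rw [← Nat.choose_symm_add] at this
    exact_mod_cast this.symm
  rw [Nat.add_sub_cancel_left, h1, h2, Nat.factorial_succ]
  push_cast
  ring

lemma sum_norm_sq_weights (p l : ℕ) :
    ∑ k ∈ Finset.range (l + 1), (l.choose k : ℂ) ^ 2 *
        ((k + 1).factorial * (p + (l - k)).factorial * (k.factorial * (l - k).factorial)) =
      (l.factorial : ℂ) ^ 2 * p.factorial * (p + l + 2).choose (p + 2) := by
  rw [Finset.sum_congr rfl fun k hk =>
    choose_sq_mul_factorials p (Nat.lt_succ_iff.mp (Finset.mem_range.mp hk)), ← Finset.mul_sum,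
    ← sum_succ_mul_choose]
  push_cast
  rfl

/-- For `h = Σ_{k=0}^{l} (−1)^k C(l,k) z₂^k z₁^{n−k} ⊗ z₁^k z₂^{l−k}` (with `n > l ≥ 1`),
`w₋ = ½(z₂∂₁ ⊗ 1)h` and `v = (X₋⊗1 + 1⊗X₋)h` with `X₋ = z₂∂₁`, one has
`⟨v,w₋⟩/⟨v,v⟩ = (n+2)/(2(n−l+2))` — the proportionality factor `λ` for the projection onto
the lowest spin subrepresentation. -/
theorem lambda_bottom (n l : ℕ) (hl : 1 ≤ l) (hnl : l < n) :
    ∀ Xminus : Module.End ℂ (MvPolynomial (Fin 2) ℂ),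
      Xminus = mulZ 1 ∘ₗ (pderiv (R := ℂ) (0 : Fin 2)).toLinearMap →
    ∀ h wminus v : MvPolynomial (Fin 2) ℂ ⊗[ℂ] MvPolynomial (Fin 2) ℂ,
      h = ∑ k ∈ Finset.range (l + 1),
            ((-1 : ℂ) ^ k * (Nat.choose l k : ℂ)) •
              ((X 1 ^ k * X 0 ^ (n - k)) ⊗ₜ[ℂ] (X 0 ^ k * X 1 ^ (l - k))) →
      wminus = ((1 : ℂ) / 2) • TensorProduct.map Xminus idP h →
      v = (TensorProduct.map Xminus idP + TensorProduct.map idP Xminus) h →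
      tinner v wminus / tinner v v = ((n : ℂ) + 2) / (2 * ((n : ℂ) - (l : ℂ) + 2)) := by
  intro Xminus hX h wminus v hh hw hv
  obtain ⟨p, rfl⟩ : ∃ p, n = p + l + 1 := ⟨n - l - 1, by omega⟩
  set c : ℕ → ℂ := fun k => (-1 : ℂ) ^ k * (Nat.choose l k : ℂ) with hc
  let e : ℕ → Fin 2 ⊕ Fin 2 →₀ ℕ := fun k => pairExponent (k + 1) (p + (l - k)) k (l - k)
  have he : Set.InjOn e (Finset.range (l + 1)) := by
    intro i _ j _ hij
    simpa [e, pairExponent] using DFunLike.congr_fun hij (Sum.inr 0)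
  have hleft : phi (TensorProduct.map Xminus idP h) =
      ∑ k ∈ Finset.range (l + 1), monomial (e k) (c k * (p + 1 + (l - k : ℕ))) := by
    rw [hh, map_sum, map_sum]
    refine Finset.sum_congr rfl fun k hk => ?_
    have hkl : k ≤ l := Nat.lt_succ_iff.mp (Finset.mem_range.mp hk)
    rw [map_smul, TensorProduct.map_tmul, hX, lowering_apply_monomial, idP, LinearMap.id_apply,
      ← TensorProduct.smul_tmul', smul_smul, phi_smul_tmul_eq_monomial,
      show p + l + 1 - k - 1 = p + (l - k) by omega, show p + l + 1 - k = p + 1 + (l - k) by omega]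
    push_cast
    rfl
  have hright : phi (TensorProduct.map idP Xminus h) =
      ∑ k ∈ Finset.range (l + 1), monomial (e k) (-(c k * (l - k : ℕ))) := by
    rw [hh, map_sum, map_sum, Finset.sum_range_succ', Finset.sum_range_succ _ l]
    congr 1
    · refine Finset.sum_congr rfl fun k hk => ?_
      have hkl : k < l := Finset.mem_range.mp hk
      rw [map_smul, TensorProduct.map_tmul, hX, mul_comm (X 0 ^ (k + 1)) (X 1 ^ (l - (k + 1))), lowering_apply_monomial,
        idP, LinearMap.id_apply, TensorProduct.tmul_smul, smul_smul, mul_comm (X 1 ^ (l - (k + 1) + 1)),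
        phi_smul_tmul_eq_monomial]
      have hchoose : (l.choose (k + 1) : ℂ) * (k + 1) = l.choose k * (l - k : ℕ) := by
        exact_mod_cast Nat.choose_succ_right_eq l k
      congr 1
      · rw [show p + l + 1 - (k + 1) = p + (l - k) by omega, show l - (k + 1) + 1 = l - k by omega]
        rfl
      · push_cast
        rw [hc, pow_succ]
        linear_combination -(-1 : ℂ) ^ k * hchoose
    · rw [map_smul, TensorProduct.map_tmul, hX, mul_comm (X 0 ^ 0), lowering_apply_monomial]
      simp
  have hw' : phi wminus =
      ∑ k ∈ Finset.range (l + 1), monomial (e k) (c k * (p + 1 + (l - k : ℕ)) / 2) := by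
    rw [hw, map_smul, hleft, Finset.smul_sum]
    refine Finset.sum_congr rfl fun k _ => ?_
    rw [smul_monomial, smul_eq_mul]
    congr 1
    ring
  have hv' : phi v = ∑ k ∈ Finset.range (l + 1), monomial (e k) (c k * (p + 1)) := by
    rw [hv, LinearMap.add_apply, map_add, hleft, hright, ← Finset.sum_add_distrib]
    refine Finset.sum_congr rfl fun k _ => ?_
    rw [← map_add]
    congr 1
    ring
  have hcsq : ∀ k, c k * c k = (l.choose k : ℂ) ^ 2 := by
    intro k
    rw [hc, mul_mul_mul_comm, ← mul_pow]
    simp [sq]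
  have hconj : ∀ k, (starRingEnd ℂ) (c k * (p + 1)) = c k * (p + 1) := by
    intro k
    simp [hc]
  have hvv : tinner v v =
      (p + 1) ^ 2 * ((l.factorial : ℂ) ^ 2 * p.factorial * (p + l + 2).choose (p + 2)) := by
    rw [tinner, hv', binner_sum_monomial _ _ he, ← sum_norm_sq_weights, Finset.mul_sum]
    refine Finset.sum_congr rfl fun k _ => ?_
    rw [hconj, prod_factorial_pairExponent, ← hcsq]
    ring
  have hvw : tinner v wminus = (p + 1) / 2 *
      ((l.factorial : ℂ) ^ 2 * (p + 1).factorial * (p + 1 + l + 2).choose (p + 1 + 2)) := by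
    rw [tinner, hv', hw', binner_sum_monomial _ _ he, ← sum_norm_sq_weights, Finset.mul_sum]
    refine Finset.sum_congr rfl fun k _ => ?_
    rw [hconj, prod_factorial_pairExponent, ← hcsq, show p + 1 + (l - k) = p + (l - k) + 1 by ring,
      Nat.factorial_succ (p + (l - k))]
    push_cast
    ring
  have hchoose : ((p + l + 3 : ℕ) : ℂ) * (p + l + 2).choose (p + 2) =
      (p + l + 3).choose (p + 3) * (p + 3 : ℕ) := by
    exact_mod_cast Nat.add_one_mul_choose_eq (p + l + 2) (p + 2)
  have hpos : ((p + l + 2).choose (p + 2) : ℂ) ≠ 0 :=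
    Nat.cast_ne_zero.mpr (Nat.choose_pos (by omega)).ne'
  have hp1 : (p + 1 : ℂ) ≠ 0 := Nat.cast_add_one_ne_zero p
  have hp3 : (p + 3 : ℂ) ≠ 0 := by exact_mod_cast (p + 2).succ_ne_zero
  have hlf : (l.factorial : ℂ) ≠ 0 := Nat.cast_ne_zero.mpr l.factorial_ne_zero
  have hpf : (p.factorial : ℂ) ≠ 0 := Nat.cast_ne_zero.mpr p.factorial_ne_zero
  rw [hvv, hvw, Nat.factorial_succ, show p + 1 + l + 2 = p + l + 3 by ring]
  push_cast at hchoose ⊢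
  rw [show (p + l + 1 - l + 2 : ℂ) = p + 3 by ring, div_eq_div_iff
    (by simp [hp1, hlf, hpf, hpos]) (by simp [hp3])]
  linear_combination -((p + 1 : ℂ) ^ 2 * (l.factorial : ℂ) ^ 2 * p.factorial) * hchoose
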